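/- arXiv:1403.3600 — 13 statements merged into one kernel-verified Lean document; each statement's English description precedes it below -/
import Mathlib

section
/- Let V be a real normed vector space with an MRD discretization (R_i : V → V_i)_{i∈ι}. Then for every finite-dimensional linear subspace W of V and every real ε with 0 < ε < 1/3 there exists an index i ∈ ι such that ‖R_i w‖ ≥ (1 − 3ε)·‖w‖ for all w ∈ W. -/
/-- Lemma (Data Stabilization, quantitative form): given an MRD (monotone,
refinable/directed, dense) discretization `(R i : V →ₗ V' i)` of a real normed
space `V`, for every finite-dimensional subspace `W` of `V` and every
`0 < ε < 1/3` there is an index `i` with `‖R i w‖ ≥ (1 - 3ε)‖w‖` on `W`. -/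
theorem mrd_uniform_stability_eps
    {V : Type*} [NormedAddCommGroup V] [NormedSpace ℝ V]
    {ι : Type*} [Preorder ι] [Nonempty ι]
    (hdir : ∀ i j : ι, ∃ k : ι, i ≤ k ∧ j ≤ k)
    (V' : ι → Type*) [∀ i, NormedAddCommGroup (V' i)] [∀ i, NormedSpace ℝ (V' i)]
    [∀ i, FiniteDimensional ℝ (V' i)]
    (R : ∀ i : ι, V →ₗ[ℝ] V' i)
    (hmono : ∀ i j : ι, i ≤ j → ∀ v : V, ‖R i v‖ ≤ ‖R j v‖)
    (hbdd : ∀ (i : ι) (v : V), ‖R i v‖ ≤ ‖v‖)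
    (hdense : ∀ v : V, (⨆ i : ι, ‖R i v‖) = ‖v‖)
    (W : Submodule ℝ V) [FiniteDimensional ℝ W]
    (ε : ℝ) (hε0 : 0 < ε) (hε1 : ε < 1 / 3) :
    ∃ i : ι, ∀ w ∈ W, (1 - 3 * ε) * ‖w‖ ≤ ‖R i w‖ := by
  have hcont : ∀ i : ι, Continuous fun w : W => ‖R i (w : V)‖ := by
    intro i
    have h : Continuous ((R i).comp W.subtype) := LinearMap.continuous_of_finiteDimensional _
    exact h.norm
  have hcomp : IsCompact (Metric.sphere (0 : W) 1) :=
    haveI := FiniteDimensional.proper ℝ W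
    isCompact_sphere _ _
  obtain ⟨i, hi⟩ := hcomp.elim_directed_cover
    (fun i : ι => {w : W | 1 - 3 * ε < ‖R i (w : V)‖})
    (fun i => isOpen_lt continuous_const (hcont i))
    (by
      intro w hw
      have hw1 : ‖(w : V)‖ = 1 := by simpa using hw
      have hlt : 1 - 3 * ε < ⨆ i : ι, ‖R i (w : V)‖ := by
        rw [hdense, hw1]; linarith
      obtain ⟨i, hi⟩ := exists_lt_of_lt_ciSup hlt
      exact Set.mem_iUnion.2 ⟨i, hi⟩)
    (by
      intro i j
      obtain ⟨k, hik, hjk⟩ := hdir i j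
      exact ⟨k, fun w hw => lt_of_lt_of_le hw (hmono i k hik _),
        fun w hw => lt_of_lt_of_le hw (hmono j k hjk _)⟩)
  refine ⟨i, fun w hw => ?_⟩
  by_cases h0 : w = 0
  · simp [h0]
  have hpos : 0 < ‖w‖ := norm_pos_iff.2 h0
  have hmem : (‖w‖⁻¹ • (⟨w, hw⟩ : W)) ∈ Metric.sphere (0 : W) 1 := by
    rw [mem_sphere_zero_iff_norm, norm_smul, norm_inv, norm_norm]
    exact inv_mul_cancel₀ hpos.ne'
  have h := hi hmem
  have h2 : 1 - 3 * ε < ‖w‖⁻¹ * ‖R i w‖ := by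
    have h3 : 1 - 3 * ε < ‖R i (‖w‖⁻¹ • w)‖ := h
    rwa [map_smul, norm_smul, norm_inv, norm_norm] at h3
  rw [inv_mul_eq_div, lt_div_iff₀ hpos] at h2
  exact h2.le
end

section
/- Let V be a real normed vector space with an MRD discretization (R_i : V → V_i)_{i∈ι}. Then for every finite-dimensional linear subspace W of V there exists an index i ∈ ι such that ‖w‖ ≤ 2·‖R_i w‖ for all w ∈ W. -/
/-- Lemma (Data Stabilization): given an MRD (monotone, refinable/directed,
dense) discretization `(R i : V →ₗ V' i)` of a real normed space `V`, for every
finite-dimensional subspace `W` of `V` there is an index `i` such that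
`‖w‖ ≤ 2‖R i w‖` for all `w ∈ W`. -/
theorem mrd_uniform_stability
    {V : Type*} [NormedAddCommGroup V] [NormedSpace ℝ V]
    {ι : Type*} [Preorder ι] [Nonempty ι]
    (hdir : ∀ i j : ι, ∃ k : ι, i ≤ k ∧ j ≤ k)
    (V' : ι → Type*) [∀ i, NormedAddCommGroup (V' i)] [∀ i, NormedSpace ℝ (V' i)]
    [∀ i, FiniteDimensional ℝ (V' i)]
    (R : ∀ i : ι, V →ₗ[ℝ] V' i)
    (hmono : ∀ i j : ι, i ≤ j → ∀ v : V, ‖R i v‖ ≤ ‖R j v‖)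
    (hbdd : ∀ (i : ι) (v : V), ‖R i v‖ ≤ ‖v‖)
    (hdense : ∀ v : V, (⨆ i : ι, ‖R i v‖) = ‖v‖)
    (W : Submodule ℝ V) [FiniteDimensional ℝ W] :
    ∃ i : ι, ∀ w ∈ W, ‖w‖ ≤ 2 * ‖R i w‖ := by
  have hcont : ∀ i, Continuous fun w : W => ‖R i (w : V)‖ := fun i =>
    (((R i).mkContinuous 1 (fun v => by simpa using hbdd i v)).continuous.comp
      continuous_subtype_val).norm
  obtain ⟨i, hi⟩ := (isCompact_sphere (0 : W) 1).elim_directed_cover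
    (fun i : ι => {w : W | 1 / 2 < ‖R i (w : V)‖})
    (fun i => isOpen_lt continuous_const (hcont i))
    (by
      intro w hw
      have hw1 : ‖(w : V)‖ = 1 := by simpa using hw
      have h : (1 / 2 : ℝ) < ⨆ i, ‖R i (w : V)‖ := by
        rw [hdense, hw1]; norm_num
      obtain ⟨i, hi⟩ := exists_lt_of_lt_ciSup h
      exact Set.mem_iUnion.2 ⟨i, hi⟩)
    (by
      intro i j
      obtain ⟨k, hik, hjk⟩ := hdir i j
      exact ⟨k, fun w hw => lt_of_lt_of_le hw (hmono i k hik w),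
        fun w hw => lt_of_lt_of_le hw (hmono j k hjk w)⟩)
  refine ⟨i, fun w hw => ?_⟩
  by_cases h0 : w = 0
  · simp [h0]
  have hpos : 0 < ‖w‖ := norm_pos_iff.2 h0
  have hmem : (‖w‖⁻¹ • (⟨w, hw⟩ : W)) ∈ Metric.sphere (0 : W) 1 := by
    rw [mem_sphere_zero_iff_norm, norm_smul, norm_inv, norm_norm]
    exact inv_mul_cancel₀ hpos.ne'
  have h : 1 / 2 < ‖R i (‖w‖⁻¹ • w)‖ := hi hmem
  rw [map_smul, norm_smul, norm_inv, norm_norm, inv_mul_eq_div, lt_div_iff₀ hpos] at h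
  linarith
end

section
/- Let V be a real normed vector space with an MRD discretization (R_i : V → V_i)_{i∈ι}, let U be a real vector space and D : U → V a linear map. Then for every finite-dimensional linear subspace U_M of U there exists an index i ∈ ι such that ‖D u‖ ≤ 2·‖R_i (D u)‖ for all u ∈ U_M. -/
/-- Theorem (uniform stability of discretized problems, data-norm form): given
an analytic problem with data map `D : U →ₗ V` and an MRD discretization
`(R i)` of the data space `V`, for every finite-dimensional trial subspace
`U_M ⊆ U` there is a restriction index `i` with `‖D u‖ ≤ 2‖R i (D u)‖` for all
`u` in the trial space. -/
theorem mrd_discretized_problem_stability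
    {V : Type*} [NormedAddCommGroup V] [NormedSpace ℝ V]
    {ι : Type*} [Preorder ι] [Nonempty ι]
    (hdir : ∀ i j : ι, ∃ k : ι, i ≤ k ∧ j ≤ k)
    (V' : ι → Type*) [∀ i, NormedAddCommGroup (V' i)] [∀ i, NormedSpace ℝ (V' i)]
    [∀ i, FiniteDimensional ℝ (V' i)]
    (R : ∀ i : ι, V →ₗ[ℝ] V' i)
    (hmono : ∀ i j : ι, i ≤ j → ∀ v : V, ‖R i v‖ ≤ ‖R j v‖)
    (hbdd : ∀ (i : ι) (v : V), ‖R i v‖ ≤ ‖v‖)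
    (hdense : ∀ v : V, (⨆ i : ι, ‖R i v‖) = ‖v‖)
    {U : Type*} [AddCommGroup U] [Module ℝ U]
    (D : U →ₗ[ℝ] V)
    (U_M : Submodule ℝ U) [FiniteDimensional ℝ U_M] :
    ∃ i : ι, ∀ u ∈ U_M, ‖D u‖ ≤ 2 * ‖R i (D u)‖ := by
  have hW : FiniteDimensional ℝ (U_M.map D) := inferInstance
  have : ProperSpace (U_M.map D) := FiniteDimensional.proper ℝ _
  have hcont : ∀ i, Continuous fun w : V => R i w := fun i =>
    ((R i).mkContinuous 1 (fun v => by simpa using hbdd i v)).continuous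
  obtain ⟨i, hi⟩ := (isCompact_sphere (0 : U_M.map D) 1).elim_directed_cover
    (fun i : ι => {w : U_M.map D | 1 / 2 < ‖R i (w : V)‖})
    (fun i => isOpen_lt continuous_const ((hcont i).comp continuous_subtype_val).norm)
    (by
      intro w hw
      have hw1 : ‖(w : V)‖ = 1 := by simpa using hw
      have hlt : (1 / 2 : ℝ) < ⨆ i : ι, ‖R i (w : V)‖ := by
        rw [hdense, hw1]; norm_num
      obtain ⟨i, hi⟩ := exists_lt_of_lt_ciSup hlt
      exact Set.mem_iUnion.2 ⟨i, hi⟩)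
    (by
      intro i j
      obtain ⟨k, hik, hjk⟩ := hdir i j
      exact ⟨k, fun w hw => lt_of_lt_of_le hw (hmono i k hik w),
        fun w hw => lt_of_lt_of_le hw (hmono j k hjk w)⟩)
  refine ⟨i, fun u hu => ?_⟩
  by_cases h0 : D u = 0
  · simp [h0]
  have hpos : 0 < ‖D u‖ := norm_pos_iff.2 h0
  have hmem : ‖D u‖⁻¹ • D u ∈ U_M.map D :=
    Submodule.smul_mem _ _ (Submodule.mem_map_of_mem hu)
  have hs : (⟨‖D u‖⁻¹ • D u, hmem⟩ : U_M.map D) ∈ Metric.sphere (0 : U_M.map D) 1 := by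
    rw [mem_sphere_zero_iff_norm]
    change ‖‖D u‖⁻¹ • D u‖ = 1
    rw [norm_smul, norm_inv, norm_norm, inv_mul_cancel₀ hpos.ne']
  have h2 : 1 / 2 < ‖R i (‖D u‖⁻¹ • D u)‖ := hi hs
  rw [map_smul, norm_smul, norm_inv, norm_norm, inv_mul_eq_div, lt_div_iff₀ hpos] at h2
  linarith
end

section
/- Let V be a real normed vector space with an MRD discretization (R_i : V → V_i)_{i∈ι}, let U be a real vector space, D : U → V a linear map, p a seminorm on U, and C > 0 a constant such that the well-posedness inequality p(u) ≤ C·‖D u‖ holds for all u ∈ U. Then for every finite-dimensional linear subspace U_M of U there exists an index i ∈ ι such that p(u) ≤ 2C·‖R_i (D u)‖ for all u ∈ U_M. -/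
/-- Theorem (uniform stability of discretized problems, well-posedness form):
given a well-posed analytic problem, i.e. a data map `D : U →ₗ V` and a
well-posedness seminorm `p` on `U` with `p u ≤ C ‖D u‖`, and an MRD
discretization `(R i)` of the data space `V`, for every finite-dimensional
trial subspace `U_M ⊆ U` there is a restriction index `i` with
`p u ≤ 2 C ‖R i (D u)‖` for all `u` in the trial space. -/
theorem mrd_discretized_problem_wellposed_stability
    {V : Type*} [NormedAddCommGroup V] [NormedSpace ℝ V]
    {ι : Type*} [Preorder ι] [Nonempty ι]
    (hdir : ∀ i j : ι, ∃ k : ι, i ≤ k ∧ j ≤ k)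
    (V' : ι → Type*) [∀ i, NormedAddCommGroup (V' i)] [∀ i, NormedSpace ℝ (V' i)]
    [∀ i, FiniteDimensional ℝ (V' i)]
    (R : ∀ i : ι, V →ₗ[ℝ] V' i)
    (hmono : ∀ i j : ι, i ≤ j → ∀ v : V, ‖R i v‖ ≤ ‖R j v‖)
    (hbdd : ∀ (i : ι) (v : V), ‖R i v‖ ≤ ‖v‖)
    (hdense : ∀ v : V, (⨆ i : ι, ‖R i v‖) = ‖v‖)
    {U : Type*} [AddCommGroup U] [Module ℝ U]
    (D : U →ₗ[ℝ] V)
    (p : Seminorm ℝ U) (C : ℝ) (hC : 0 < C)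
    (hwp : ∀ u : U, p u ≤ C * ‖D u‖)
    (U_M : Submodule ℝ U) [FiniteDimensional ℝ U_M] :
    ∃ i : ι, ∀ u ∈ U_M, p u ≤ 2 * C * ‖R i (D u)‖ := by
  classical
  let W : Submodule ℝ V := U_M.map D
  have : FiniteDimensional ℝ W := inferInstance
  have : ProperSpace W := FiniteDimensional.proper ℝ W
  have hcont : ∀ i, Continuous (fun w : W => ‖R i (w : V)‖) := fun i =>
    (((R i).mkContinuous 1 (fun v => by simpa using hbdd i v)).continuous.comp
      continuous_subtype_val).norm
  obtain ⟨i, hi⟩ := (isCompact_sphere (0 : W) 1).elim_directed_cover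
    (fun i : ι => {w : W | (1 / 2 : ℝ) < ‖R i (w : V)‖})
    (fun i => isOpen_lt continuous_const (hcont i))
    (by
      intro w hw
      have hw1 : ‖(w : V)‖ = 1 := by simpa using hw
      have h : (1 / 2 : ℝ) < ⨆ i : ι, ‖R i (w : V)‖ := by
        rw [hdense, hw1]; norm_num
      obtain ⟨i, hi⟩ := exists_lt_of_lt_ciSup h
      exact Set.mem_iUnion.2 ⟨i, hi⟩)
    (by
      intro i j
      obtain ⟨k, hik, hjk⟩ := hdir i j
      exact ⟨k, fun w hw => lt_of_lt_of_le hw (hmono i k hik _),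
        fun w hw => lt_of_lt_of_le hw (hmono j k hjk _)⟩)
  refine ⟨i, fun u hu => ?_⟩
  have key : ‖D u‖ ≤ 2 * ‖R i (D u)‖ := by
    by_cases h0 : D u = 0
    · simp [h0]
    have hpos : 0 < ‖D u‖ := norm_pos_iff.2 h0
    let w : W := ‖D u‖⁻¹ • ⟨D u, Submodule.mem_map_of_mem hu⟩
    have hwv : (w : V) = ‖D u‖⁻¹ • D u := rfl
    have hws : w ∈ Metric.sphere (0 : W) 1 := by
      rw [mem_sphere_zero_iff_norm, ← Submodule.norm_coe, hwv, norm_smul, norm_inv, norm_norm]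
      exact inv_mul_cancel₀ hpos.ne'
    have h : (1 / 2 : ℝ) < ‖R i (w : V)‖ := hi hws
    rw [hwv, map_smul, norm_smul, norm_inv, norm_norm, inv_mul_eq_div, lt_div_iff₀ hpos] at h
    linarith
  calc p u ≤ C * ‖D u‖ := hwp u
    _ ≤ C * (2 * ‖R i (D u)‖) := by gcongr
    _ = 2 * C * ‖R i (D u)‖ := by ring
end

section
/- Let u* ∈ U and let ũ, u*_M ∈ U_M satisfy the quasi-minimal residual condition ‖R(D(u* − ũ))‖ ≤ C_A·‖R(D(u* − u*_M))‖. Then ‖D(ũ − u*_M)‖ ≤ (2C_A + 2)·‖D(u* − u*_M)‖. -/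
/-- If the trial space `U_M` is uniformly stable under the restriction `R`
(`‖D w‖ ≤ 2‖R (D w)‖` on `U_M`) and `ũ, u_M* ∈ U_M` satisfy the quasi-minimal
residual condition, then `‖D(ũ - u_M*)‖ ≤ (2 C_A + 2) ‖D(u* - u_M*)‖`. -/
theorem residual_min_data_bound_between_trial_elements
    {U V V_N : Type*} [AddCommGroup U] [Module ℝ U]
    [NormedAddCommGroup V] [NormedSpace ℝ V]
    [NormedAddCommGroup V_N] [NormedSpace ℝ V_N]
    (D : U →ₗ[ℝ] V) (R : V →ₗ[ℝ] V_N)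
    (hR : ∀ v : V, ‖R v‖ ≤ ‖v‖)
    (U_M : Submodule ℝ U)
    (hstab : ∀ w ∈ U_M, ‖D w‖ ≤ 2 * ‖R (D w)‖)
    (C_A : ℝ) (hCA : 1 ≤ C_A)
    (ustar : U) (utilde uMstar : U)
    (hutilde : utilde ∈ U_M) (huMstar : uMstar ∈ U_M)
    (hqm : ‖R (D (ustar - utilde))‖ ≤ C_A * ‖R (D (ustar - uMstar))‖) :
    ‖D (utilde - uMstar)‖ ≤ (2 * C_A + 2) * ‖D (ustar - uMstar)‖ := by
  have h1 := hstab _ (U_M.sub_mem hutilde huMstar)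
  have h2 : R (D (utilde - uMstar)) = R (D (ustar - uMstar)) - R (D (ustar - utilde)) := by
    rw [← map_sub, ← map_sub]
    congr 2
    abel
  have h3 := norm_sub_le (R (D (ustar - uMstar))) (R (D (ustar - utilde)))
  rw [← h2] at h3
  have h4 : (2 * C_A + 2) * ‖R (D (ustar - uMstar))‖ ≤ (2 * C_A + 2) * ‖D (ustar - uMstar)‖ :=
    mul_le_mul_of_nonneg_left (hR _) (by linarith)
  linarith
end

section
/- Let u* ∈ U and let ũ, u*_M ∈ U_M satisfy the quasi-minimal residual condition ‖R(D(u* − ũ))‖ ≤ C_A·‖R(D(u* − u*_M))‖. Then ‖D(ũ − u*)‖ ≤ (2C_A + 3)·‖D(u*_M − u*)‖; that is, the error of the computational solution ũ in the data seminorm is bounded by (2C_A + 3) times the error of the comparison trial object u*_M in the data seminorm. -/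
/-- Theorem (convergence of residual minimization in the data seminorm): under
uniform stability of the trial space `U_M` and the quasi-minimal residual
condition, the error of the computational solution `ũ` is bounded by
`(2 C_A + 3)` times the error of the comparison trial object `u_M*`, both
measured in the data seminorm `‖u‖_D = ‖D u‖`. -/
theorem residual_min_data_error_bound
    {U V V_N : Type*} [AddCommGroup U] [Module ℝ U]
    [NormedAddCommGroup V] [NormedSpace ℝ V]
    [NormedAddCommGroup V_N] [NormedSpace ℝ V_N]
    (D : U →ₗ[ℝ] V) (R : V →ₗ[ℝ] V_N)
    (hR : ∀ v : V, ‖R v‖ ≤ ‖v‖)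
    (U_M : Submodule ℝ U)
    (hstab : ∀ w ∈ U_M, ‖D w‖ ≤ 2 * ‖R (D w)‖)
    (C_A : ℝ) (hCA : 1 ≤ C_A)
    (ustar : U) (utilde uMstar : U)
    (hutilde : utilde ∈ U_M) (huMstar : uMstar ∈ U_M)
    (hqm : ‖R (D (ustar - utilde))‖ ≤ C_A * ‖R (D (ustar - uMstar))‖) :
    ‖D (utilde - ustar)‖ ≤ (2 * C_A + 3) * ‖D (uMstar - ustar)‖ := by
  have h1 := hstab _ (U_M.sub_mem hutilde huMstar)
  have h2 : R (D (utilde - uMstar)) = R (D (ustar - uMstar)) - R (D (ustar - utilde)) := by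
    simp only [map_sub]; abel
  have h3 := norm_sub_le (R (D (ustar - uMstar))) (R (D (ustar - utilde)))
  rw [← h2] at h3
  have h4 := hR (D (ustar - uMstar))
  have h5 : D (utilde - ustar) = D (utilde - uMstar) + D (uMstar - ustar) := by
    rw [← map_add]; congr 1; abel
  have h6 := norm_add_le (D (utilde - uMstar)) (D (uMstar - ustar))
  rw [← h5] at h6
  have h7 : ‖D (ustar - uMstar)‖ = ‖D (uMstar - ustar)‖ := by
    rw [← neg_sub, map_neg, norm_neg]
  rw [h7] at h4
  have h8 := mul_le_mul_of_nonneg_left h4 (by linarith : (0:ℝ) ≤ C_A)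
  linarith
end

section
/- Assume in addition that p is a seminorm on U and C > 0 a constant with the well-posedness inequality p(u) ≤ C·‖D u‖ for all u ∈ U. Let u* ∈ U and let ũ, u*_M ∈ U_M satisfy ‖R(D(u* − ũ))‖ ≤ C_A·‖R(D(u* − u*_M))‖. Then p(u* − ũ) ≤ C·(2C_A + 3)·‖D(u*_M − u*)‖, i.e. convergence rates of the trial space data approximation in the data norm transfer to the same rates in the well-posedness seminorm. -/
/-- Corollary (convergence in the well-posedness seminorm): adding the
well-posedness inequality `p u ≤ C ‖D u‖` to the residual-minimization error
bound yields `p (u* - ũ) ≤ C (2 C_A + 3) ‖D(u_M* - u*)‖`, i.e. convergence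
rates of the trial space data approximation in the data norm transfer to the
well-posedness seminorm. -/
theorem residual_min_wellposed_error_bound
    {U V V_N : Type*} [AddCommGroup U] [Module ℝ U]
    [NormedAddCommGroup V] [NormedSpace ℝ V]
    [NormedAddCommGroup V_N] [NormedSpace ℝ V_N]
    (D : U →ₗ[ℝ] V) (R : V →ₗ[ℝ] V_N)
    (hR : ∀ v : V, ‖R v‖ ≤ ‖v‖)
    (U_M : Submodule ℝ U)
    (hstab : ∀ w ∈ U_M, ‖D w‖ ≤ 2 * ‖R (D w)‖)
    (C_A : ℝ) (hCA : 1 ≤ C_A)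
    (p : Seminorm ℝ U) (C : ℝ) (hC : 0 < C)
    (hwp : ∀ u : U, p u ≤ C * ‖D u‖)
    (ustar : U) (utilde uMstar : U)
    (hutilde : utilde ∈ U_M) (huMstar : uMstar ∈ U_M)
    (hqm : ‖R (D (ustar - utilde))‖ ≤ C_A * ‖R (D (ustar - uMstar))‖) :
    p (ustar - utilde) ≤ C * (2 * C_A + 3) * ‖D (uMstar - ustar)‖ := by
  have e1 : D (ustar - utilde) = D (ustar - uMstar) + D (uMstar - utilde) := by
    rw [← map_add]; congr 1; abel
  have e2 : R (D (uMstar - utilde)) = R (D (ustar - utilde)) - R (D (ustar - uMstar)) := by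
    rw [← map_sub, ← map_sub]; congr 2; abel
  have e3 : ‖D (uMstar - ustar)‖ = ‖D (ustar - uMstar)‖ := by
    rw [map_sub, map_sub, norm_sub_rev]
  have h1 := hstab _ (U_M.sub_mem huMstar hutilde)
  have h2 : ‖R (D (uMstar - utilde))‖ ≤ ‖R (D (ustar - utilde))‖ + ‖R (D (ustar - uMstar))‖ := by
    rw [e2]; exact norm_sub_le _ _
  have h3 : ‖D (ustar - utilde)‖ ≤ ‖D (ustar - uMstar)‖ + ‖D (uMstar - utilde)‖ := by
    rw [e1]; exact norm_add_le _ _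
  have h4 := hR (D (ustar - uMstar))
  have h5 : C_A * ‖R (D (ustar - uMstar))‖ ≤ C_A * ‖D (ustar - uMstar)‖ :=
    mul_le_mul_of_nonneg_left h4 (by linarith)
  rw [e3, mul_assoc]
  refine (hwp _).trans (mul_le_mul_of_nonneg_left ?_ hC.le)
  linarith
end

section
/- Let v* ∈ V be given (possibly noisy) data, and let ũ, u*_M ∈ U_M satisfy the quasi-minimal residual condition ‖R v* − R(D ũ)‖ ≤ C_A·‖R v* − R(D u*_M)‖. Then for every u* ∈ U one has ‖D(ũ − u*)‖ ≤ (2C_A + 3)·‖D(u*_M − u*)‖ + (2C_A + 2)·‖v* − D u*‖. -/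
/-- Theorem (residual minimization with noisy data): if the given data `v*` is
a general element of the data space and `ũ, u_M* ∈ U_M` satisfy the
quasi-minimal residual condition with respect to `v*`, then for every `u* ∈ U`
one has
`‖D(ũ - u*)‖ ≤ (2 C_A + 3) ‖D(u_M* - u*)‖ + (2 C_A + 2) ‖v* - D u*‖`. -/
theorem residual_min_noisy_data_error_bound
    {U V V_N : Type*} [AddCommGroup U] [Module ℝ U]
    [NormedAddCommGroup V] [NormedSpace ℝ V]
    [NormedAddCommGroup V_N] [NormedSpace ℝ V_N]
    (D : U →ₗ[ℝ] V) (R : V →ₗ[ℝ] V_N)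
    (hR : ∀ v : V, ‖R v‖ ≤ ‖v‖)
    (U_M : Submodule ℝ U)
    (hstab : ∀ w ∈ U_M, ‖D w‖ ≤ 2 * ‖R (D w)‖)
    (C_A : ℝ) (hCA : 1 ≤ C_A)
    (vstar : V) (utilde uMstar : U)
    (hutilde : utilde ∈ U_M) (huMstar : uMstar ∈ U_M)
    (hqm : ‖R vstar - R (D utilde)‖ ≤ C_A * ‖R vstar - R (D uMstar)‖) :
    ∀ ustar : U,
      ‖D (utilde - ustar)‖ ≤
        (2 * C_A + 3) * ‖D (uMstar - ustar)‖ + (2 * C_A + 2) * ‖vstar - D ustar‖ := by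
  intro ustar
  have h1 := hstab _ (U_M.sub_mem hutilde huMstar)
  have h2 : ‖R (D (utilde - uMstar))‖
      ≤ ‖R vstar - R (D uMstar)‖ + ‖R vstar - R (D utilde)‖ := by
    have e : R (D (utilde - uMstar))
        = (R vstar - R (D uMstar)) - (R vstar - R (D utilde)) := by
      simp only [map_sub]; abel
    rw [e]
    exact norm_sub_le _ _
  have h3 : ‖R vstar - R (D uMstar)‖ ≤ ‖vstar - D ustar‖ + ‖D (uMstar - ustar)‖ := by
    have e : vstar - D uMstar = (vstar - D ustar) - D (uMstar - ustar) := by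
      simp only [map_sub]; abel
    rw [← map_sub]
    refine (hR _).trans ?_
    rw [e]
    exact norm_sub_le _ _
  have h4 : ‖D (utilde - ustar)‖ ≤ ‖D (utilde - uMstar)‖ + ‖D (uMstar - ustar)‖ := by
    have e : D (utilde - ustar) = D (utilde - uMstar) + D (uMstar - ustar) := by
      simp only [map_sub]; abel
    rw [e]
    exact norm_add_le _ _
  have h5 := mul_le_mul_of_nonneg_left h3 (by linarith : (0:ℝ) ≤ C_A)
  linarith
end

section
/- Let v* ∈ V be given (possibly noisy) data, and let ũ, u*_M ∈ U_M satisfy the quasi-minimal residual condition ‖R v* − R(D ũ)‖ ≤ C_A·‖R v* − R(D u*_M)‖. Then the backward error bound ‖v* − D ũ‖ ≤ (2C_A + 3)·‖v* − D u*_M‖ holds: the computed trial element reproduces the given data at the quality of the comparison trial object, up to the factor 2C_A + 3. -/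
/-- Corollary (backward error bound): under uniform stability of the trial
space and the quasi-minimal residual condition with respect to general data
`v*`, the computed trial element `ũ` reproduces the given data at the quality
of the comparison trial object: `‖v* - D ũ‖ ≤ (2 C_A + 3) ‖v* - D u_M*‖`. -/
theorem residual_min_backward_error_bound
    {U V V_N : Type*} [AddCommGroup U] [Module ℝ U]
    [NormedAddCommGroup V] [NormedSpace ℝ V]
    [NormedAddCommGroup V_N] [NormedSpace ℝ V_N]
    (D : U →ₗ[ℝ] V) (R : V →ₗ[ℝ] V_N)
    (hR : ∀ v : V, ‖R v‖ ≤ ‖v‖)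
    (U_M : Submodule ℝ U)
    (hstab : ∀ w ∈ U_M, ‖D w‖ ≤ 2 * ‖R (D w)‖)
    (C_A : ℝ) (hCA : 1 ≤ C_A)
    (vstar : V) (utilde uMstar : U)
    (hutilde : utilde ∈ U_M) (huMstar : uMstar ∈ U_M)
    (hqm : ‖R vstar - R (D utilde)‖ ≤ C_A * ‖R vstar - R (D uMstar)‖) :
    ‖vstar - D utilde‖ ≤ (2 * C_A + 3) * ‖vstar - D uMstar‖ := by
  have h1 := hstab (uMstar - utilde) (U_M.sub_mem huMstar hutilde)
  have h2 : ‖R vstar - R (D uMstar)‖ ≤ ‖vstar - D uMstar‖ := by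
    rw [← map_sub]
    exact hR _
  have h3 : ‖R (D (uMstar - utilde))‖
      ≤ ‖R vstar - R (D utilde)‖ + ‖R vstar - R (D uMstar)‖ := by
    have e : R (D (uMstar - utilde))
        = (R vstar - R (D utilde)) - (R vstar - R (D uMstar)) := by
      rw [map_sub, map_sub]
      abel
    rw [e]
    exact norm_sub_le _ _
  have h4 : ‖vstar - D utilde‖ ≤ ‖vstar - D uMstar‖ + ‖D (uMstar - utilde)‖ := by
    have e : vstar - D utilde = (vstar - D uMstar) + D (uMstar - utilde) := by
      rw [map_sub]
      abel
    rw [e]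
    exact norm_add_le _ _
  have h5 : C_A * ‖R vstar - R (D uMstar)‖ ≤ C_A * ‖vstar - D uMstar‖ :=
    mul_le_mul_of_nonneg_left h2 (by linarith)
  linarith
end

section
/- Let u* : Ω → ℝ be the true solution, set a*_j := u*(x_j), let s* := Σ_{j=1}^M a*_j·s_j be the trial function with the nodal values of u*, and set f_k := λ_k(u*). Let ã ∈ ℝ^M satisfy the quasi-minimal residual condition max_{1≤k≤N} |f_k − Σ_j ã_j·λ_k(s_j)| ≤ C_A·max_{1≤k≤N} |f_k − Σ_j a*_j·λ_k(s_j)| with a constant C_A ≥ 1, and let ũ := Σ_{j=1}^M ã_j·s_j. Then the error on the nodes satisfies max_{1≤j≤M} |u*(x_j) − ũ(x_j)| ≤ 2·γ·C·(1 + C_A)·max_{1≤k≤N} |λ_k(u* − s*)|. -/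
/-- Corollary (nodal convergence): for a nodal basis, the error of the
quasi-minimal residual solution `ũ = Σ ã_j s_j`, evaluated on the nodes, is
bounded by `2 γ C (1 + C_A)` times the data error `max_k |λ_k(u* - s*)|` of the
trial function `s*` carrying the nodal values of the true solution `u*`. -/
theorem nodal_basis_error_on_nodes
    {Ω : Type*} {M N : ℕ} (hM : 0 < M) (hN : 0 < N)
    (s : Fin M → Ω → ℝ) (x : Fin M → Ω)
    (hnodal : ∀ j k : Fin M, s j (x k) = if j = k then 1 else 0)
    (p : (Ω → ℝ) → ℝ) (γ C : ℝ) (hγ : 0 < γ) (hC : 0 < C)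
    (heval : ∀ u ∈ Submodule.span ℝ (Set.range s), ∀ j : Fin M, |u (x j)| ≤ γ * p u)
    (lam : Fin N → (Ω → ℝ) →ₗ[ℝ] ℝ)
    (hstab : ∀ u ∈ Submodule.span ℝ (Set.range s),
      p u ≤ 2 * C * (Finset.univ.sup'
        (Finset.univ_nonempty_iff.mpr (Fin.pos_iff_nonempty.mp hN))
        fun k : Fin N => |lam k u|))
    (ustar : Ω → ℝ) (C_A : ℝ) (hCA : 1 ≤ C_A)
    (atilde : Fin M → ℝ)
    (hqm : (Finset.univ.sup'
        (Finset.univ_nonempty_iff.mpr (Fin.pos_iff_nonempty.mp hN))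
        fun k : Fin N => |lam k ustar - ∑ j, atilde j * lam k (s j)|) ≤
      C_A * (Finset.univ.sup'
        (Finset.univ_nonempty_iff.mpr (Fin.pos_iff_nonempty.mp hN))
        fun k : Fin N => |lam k ustar - ∑ j, ustar (x j) * lam k (s j)|)) :
    (Finset.univ.sup' (Finset.univ_nonempty_iff.mpr (Fin.pos_iff_nonempty.mp hM))
        fun j : Fin M => |ustar (x j) - (∑ i, atilde i • s i) (x j)|) ≤
      2 * γ * C * (1 + C_A) * (Finset.univ.sup'
        (Finset.univ_nonempty_iff.mpr (Fin.pos_iff_nonempty.mp hN))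
        fun k : Fin N => |lam k (ustar - ∑ i, ustar (x i) • s i)|) := by
  have hl : ∀ (k : Fin N) (a : Fin M → ℝ),
      lam k (∑ i, a i • s i) = ∑ i, a i * lam k (s i) := by
    intro k a
    simp [map_sum]
  have hmem : ∀ a : Fin M → ℝ, (∑ i, a i • s i) ∈ Submodule.span ℝ (Set.range s) := by
    intro a
    exact Submodule.sum_mem _ fun i _ =>
      Submodule.smul_mem _ _ (Submodule.subset_span ⟨i, rfl⟩)
  have hval : ∀ j, (∑ i, ustar (x i) • s i) (x j) = ustar (x j) := by
    intro j
    simp [Finset.sum_apply, hnodal]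
  simp only [map_sub, hl]
  set D := Finset.univ.sup'
        (Finset.univ_nonempty_iff.mpr (Fin.pos_iff_nonempty.mp hN))
        (fun k : Fin N => |lam k ustar - ∑ j, ustar (x j) * lam k (s j)|) with hD
  have hw := Submodule.sub_mem _ (hmem fun i => ustar (x i)) (hmem atilde)
  have hS : (Finset.univ.sup'
        (Finset.univ_nonempty_iff.mpr (Fin.pos_iff_nonempty.mp hN))
        fun k : Fin N => |lam k ((∑ i, ustar (x i) • s i) - ∑ i, atilde i • s i)|)
        ≤ (1 + C_A) * D := by
    refine Finset.sup'_le _ _ fun k _ => ?_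
    have h1 := (Finset.sup'_le_iff _ _).1 hqm k (Finset.mem_univ k)
    have h2 : |lam k ustar - ∑ j, ustar (x j) * lam k (s j)| ≤ D :=
      Finset.le_sup' (fun k : Fin N => |lam k ustar - ∑ j, ustar (x j) * lam k (s j)|)
        (Finset.mem_univ k)
    rw [map_sub, hl, hl]
    rw [abs_le] at h1 h2 ⊢
    constructor <;> linarith [h1.1, h1.2, h2.1, h2.2]
  refine Finset.sup'_le _ _ fun j _ => ?_
  have h3 := heval _ hw j
  rw [Pi.sub_apply, hval] at h3
  calc _ ≤ _ := h3
    _ ≤ γ * (2 * C * ((1 + C_A) * D)) := by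
      refine mul_le_mul_of_nonneg_left ((hstab _ hw).trans ?_) hγ.le
      exact mul_le_mul_of_nonneg_left hS (by positivity)
    _ = _ := by ring
end

section
/- For every continuous linear functional μ on U, the recovery strategy u ↦ μ(P u) is error-optimal among all linear recovery procedures using the data λ_1(u), …, λ_N(u): for every w ∈ ℝ^N one has ‖μ − μ∘P‖_{U*} ≤ ‖μ − Σ_{j=1}^N w_j·λ_j‖_{U*}, where ‖·‖_{U*} is the operator norm on the continuous dual of U. -/
open scoped RealInnerProductSpace

/-- Theorem (optimal recovery, optimality part): in a real Hilbert space `U`,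
let `λ_1, …, λ_N` be continuous linear functionals with Riesz representers
`u_1, …, u_N`, and let `P` be the orthogonal projection onto
`span{u_1, …, u_N}` (characterized by `P v` lying in the span and `v - P v`
being orthogonal to the span). Then for every continuous linear functional `μ`
the recovery strategy `v ↦ μ(P v)` is error-optimal among all linear recovery
procedures using the data `λ_1(v), …, λ_N(v)`: the error functional
`μ - μ ∘ P` has minimal operator norm among all `μ - Σ_j w_j λ_j`. -/
theorem optimal_recovery_optimality
    {U : Type*} [NormedAddCommGroup U] [InnerProductSpace ℝ U] [CompleteSpace U]
    {N : ℕ} (u : Fin N → U)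
    (lam : Fin N → U →L[ℝ] ℝ)
    (hriesz : ∀ (j : Fin N) (v : U), lam j v = ⟪u j, v⟫)
    (P : U →L[ℝ] U)
    (hP : ∀ v : U, P v ∈ Submodule.span ℝ (Set.range u) ∧
      v - P v ∈ (Submodule.span ℝ (Set.range u))ᗮ) :
    ∀ μ : U →L[ℝ] ℝ, ∀ w : Fin N → ℝ,
      ‖μ - μ.comp P‖ ≤ ‖μ - ∑ j, w j • lam j‖ := by
  intro μ w
  refine ContinuousLinearMap.opNorm_le_bound _ (norm_nonneg _) fun v => ?_
  obtain ⟨h1, h2⟩ := hP v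
  have h3 : ∀ j, lam j (v - P v) = 0 := fun j => by
    rw [hriesz]
    exact (Submodule.mem_orthogonal _ _).1 h2 _ (Submodule.subset_span ⟨j, rfl⟩)
  have h4 : (μ - μ.comp P) v = (μ - ∑ j, w j • lam j) (v - P v) := by
    have h5 : (∑ j, w j • lam j) (v - P v) = 0 := by
      rw [ContinuousLinearMap.sum_apply]
      exact Finset.sum_eq_zero fun j _ => by
        rw [ContinuousLinearMap.smul_apply, h3, smul_zero]
    rw [ContinuousLinearMap.sub_apply, ContinuousLinearMap.sub_apply, h5, sub_zero, map_sub,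
      ContinuousLinearMap.comp_apply]
  have h6 : ‖v - P v‖ ≤ ‖v‖ := by
    have h7 : ⟪P v, v - P v⟫ = 0 := (Submodule.mem_orthogonal _ _).1 h2 _ h1
    have h8 := norm_add_sq_eq_norm_sq_add_norm_sq_real h7
    rw [add_sub_cancel] at h8
    nlinarith [norm_nonneg v, norm_nonneg (v - P v), norm_nonneg (P v)]
  rw [h4]
  exact (ContinuousLinearMap.le_opNorm _ _).trans
    (mul_le_mul_of_nonneg_left h6 (norm_nonneg _))
end

section
/- Let Ω ⊆ ℝ^d be a nonempty compact set that equals the closure of its interior, let f : ℝ^d → ℝ be continuous, and let r > 0. Then the supremum, over all Lebesgue-measurable sets S ⊆ Ω with vol(S) > 0 and diam(S) ≤ r, of the absolute mean value |⨍_S f| = |(vol S)^{-1} ∫_S f dvol| equals the supremum norm sup_{x ∈ Ω} |f(x)|. -/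
open MeasureTheory

/-- Lemma (MLPG well-posedness lemma): for a continuous function `f` and a
nonempty compact set `Ω ⊆ ℝ^d` that is the closure of its interior, the
supremum of the absolute mean values `|⨍_S f|` over all measurable subsets
`S ⊆ Ω` of positive volume and diameter at most `r` equals the supremum norm
`sup_{x ∈ Ω} |f x|`. -/
theorem sup_abs_mean_eq_sup_norm
    {d : ℕ} (hd : 0 < d)
    (Ω : Set (EuclideanSpace ℝ (Fin d)))
    (hne : Ω.Nonempty) (hcomp : IsCompact Ω) (hreg : Ω = closure (interior Ω))
    (f : EuclideanSpace ℝ (Fin d) → ℝ) (hf : Continuous f)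
    (r : ℝ) (hr : 0 < r) :
    sSup {m : ℝ | ∃ S : Set (EuclideanSpace ℝ (Fin d)),
        MeasurableSet S ∧ S ⊆ Ω ∧ 0 < volume S ∧ Metric.diam S ≤ r ∧
        m = |⨍ x in S, f x|} = ⨆ x ∈ Ω, |f x| := by
  obtain ⟨x₀, hx₀, hmax⟩ := hcomp.exists_isMaxOn hne (f := fun x => |f x|)
    hf.abs.continuousOn
  have hmax' : ∀ x ∈ Ω, |f x| ≤ |f x₀| := fun x hx => hmax hx
  have hΩfin : volume Ω < ⊤ := hcomp.measure_lt_top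
  have hint : IntegrableOn f Ω volume := hf.continuousOn.integrableOn_compact hcomp
  -- averages stay in closed balls containing the values
  have key : ∀ (S : Set (EuclideanSpace ℝ (Fin d))) (c R : ℝ), MeasurableSet S → S ⊆ Ω →
      0 < volume S → (∀ x ∈ S, |f x - c| ≤ R) → |(⨍ x in S, f x) - c| ≤ R := by
    intro S c R hS hSΩ hpos hb
    have h := (convex_closedBall c R).set_average_mem Metric.isClosed_closedBall hpos.ne'
      (lt_of_le_of_lt (measure_mono hSΩ) hΩfin).ne
      (f := f) (ae_restrict_of_forall_mem hS (fun x hx => by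
        rw [Metric.mem_closedBall, Real.dist_eq]; exact hb x hx))
      (hint.mono_set hSΩ)
    rwa [Metric.mem_closedBall, Real.dist_eq] at h
  have hR : (⨆ x ∈ Ω, |f x|) = |f x₀| := by
    have hle : ∀ x, (⨆ _ : x ∈ Ω, |f x|) ≤ |f x₀| := fun x =>
      Real.iSup_le (fun hx => hmax' x hx) (abs_nonneg _)
    apply le_antisymm
    · exact Real.iSup_le hle (abs_nonneg _)
    · have h := le_ciSup (f := fun x => ⨆ _ : x ∈ Ω, |f x|)
        ⟨|f x₀|, by rintro _ ⟨x, rfl⟩; exact hle x⟩ x₀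
      simpa [hx₀] using h
  rw [hR]
  have hub : ∀ m ∈ {m : ℝ | ∃ S : Set (EuclideanSpace ℝ (Fin d)),
        MeasurableSet S ∧ S ⊆ Ω ∧ 0 < volume S ∧ Metric.diam S ≤ r ∧
        m = |⨍ x in S, f x|}, m ≤ |f x₀| := by
    rintro m ⟨S, hS, hSΩ, hpos, -, rfl⟩
    simpa using key S 0 |f x₀| hS hSΩ hpos (fun x hx => by simpa using hmax' x (hSΩ hx))
  apply le_antisymm
  · exact Real.sSup_le hub (abs_nonneg _)
  · apply le_of_forall_pos_le_add
    intro ε hε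
    obtain ⟨δ, hδ, hδf⟩ := Metric.continuous_iff.1 hf x₀ ε hε
    have hx₁ : x₀ ∈ closure (interior Ω) := hreg ▸ hx₀
    obtain ⟨y, hy, hyd⟩ := Metric.mem_closure_iff.1 hx₁ δ hδ
    have hopen : IsOpen (interior Ω ∩ Metric.ball x₀ δ) :=
      isOpen_interior.inter Metric.isOpen_ball
    obtain ⟨ρ, hρ, hsub⟩ := Metric.isOpen_iff.1 hopen y
      ⟨hy, by rwa [Metric.mem_ball, dist_comm]⟩
    have hτ : 0 < min ρ (r / 2) := lt_min hρ (by linarith)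
    have hsub' : Metric.ball y (min ρ (r / 2)) ⊆ interior Ω ∩ Metric.ball x₀ δ :=
      (Metric.ball_subset_ball (min_le_left _ _)).trans hsub
    have hSΩ : Metric.ball y (min ρ (r / 2)) ⊆ Ω := fun x hx =>
      interior_subset (hsub' hx).1
    have hpos : 0 < volume (Metric.ball y (min ρ (r / 2))) := Metric.measure_ball_pos _ _ hτ
    have hk := key _ (f x₀) ε measurableSet_ball hSΩ hpos (fun x hx => by
      have := hδf x (hsub' hx).2
      rw [Real.dist_eq] at this
      exact this.le)
    have hdiam : Metric.diam (Metric.ball y (min ρ (r / 2))) ≤ r :=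
      (Metric.diam_ball hτ.le).trans (by linarith [min_le_right ρ (r / 2)])
    have hle := le_csSup ⟨|f x₀|, hub⟩ ⟨_, measurableSet_ball, hSΩ, hpos, hdiam, rfl⟩
    have h3 := abs_sub_abs_le_abs_sub (f x₀) (⨍ x in Metric.ball y (min ρ (r / 2)), f x)
    rw [abs_sub_comm] at h3
    linarith
end

section
/- Let n ≥ 1 and N ≥ 2n² be integers, and let t_k := −1 + 2k/N for k = 0, 1, …, N be the N+1 equidistant points in [−1, 1]. Then every real polynomial p of degree at most n satisfies the uniform stability inequality sup_{x ∈ [−1,1]} |p(x)| ≤ 2·max_{0 ≤ k ≤ N} |p(t_k)|. -/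
open Polynomial in
theorem aux_endpoint {n : ℕ} {P : ℝ[X]} (hd : P.natDegree ≤ n)
    (hb : ∀ x ∈ Set.Icc (-1 : ℝ) 1, |P.eval x| ≤ 1) :
    |(derivative (derivative P)).eval 1| ≤ (n : ℝ) ^ 4 / 3 := by
  have hT : (derivative^[2] (Chebyshev.T ℝ n)).eval 1 ≤ (n : ℝ) ^ 4 / 3 := by
    have h1 := Chebyshev.iterate_derivative_T_eval_one_recurrence (R := ℝ) n 1
    have h2 := Chebyshev.derivative_T_eval_one (R := ℝ) n
    simp only [Function.iterate_one, h2] at h1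
    norm_num at h1 ⊢
    nlinarith [sq_nonneg (n : ℝ)]
  have hdeg : P.degree ≤ n := natDegree_le_iff_degree_le.mp hd
  have a := Chebyshev.eval_iterate_derivative_le_of_forall_abs_le_one (k := 2) le_rfl hdeg hb
  have b := Chebyshev.eval_iterate_derivative_le_of_forall_abs_le_one (P := -P) (k := 2)
    (x := 1) le_rfl (by rwa [degree_neg]) (by simpa using hb)
  simp only [Function.iterate_succ, Function.iterate_zero, Function.comp, id, derivative_neg,
    eval_neg] at a b hT
  rw [abs_le]
  constructor <;> linarith

open Polynomial in
theorem aux_half {n : ℕ} {P : ℝ[X]} (hd : P.natDegree ≤ n)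
    (hb : ∀ x ∈ Set.Icc (-1 : ℝ) 1, |P.eval x| ≤ 1) {y : ℝ} (h0 : 0 ≤ y) (h1 : y ≤ 1) :
    |(derivative (derivative P)).eval y| ≤ 4 * (n : ℝ) ^ 4 / 3 := by
  set c : ℝ := (1 + y) / 2 with hc
  have key := aux_endpoint (n := n) (P := P.comp (C c * X + C (c - 1))) ?_ ?_
  · simp only [derivative_comp, derivative_mul, derivative_add, derivative_C, derivative_X,
      eval_mul, eval_comp, eval_add, eval_C, eval_X, zero_mul, mul_one, zero_add, add_zero,
      mul_zero, eval_zero] at key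
    rw [show c + (c - 1) = y by rw [hc]; ring] at key
    rw [abs_mul, abs_mul, abs_of_nonneg (by linarith : 0 ≤ c)] at key
    have := abs_nonneg ((derivative (derivative P)).eval y)
    have hc2 : 1 / 4 ≤ c * c := by nlinarith
    nlinarith
  · refine natDegree_comp_le.trans ?_
    have : (C c * X + C (c - 1)).natDegree ≤ 1 := natDegree_linear_le
    calc _ ≤ P.natDegree * 1 := Nat.mul_le_mul_left _ this
      _ ≤ n := by simpa using hd
  · intro x hx
    have := hx.1
    have := hx.2
    rw [eval_comp]
    apply hb
    simp only [eval_add, eval_mul, eval_C, eval_X]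
    constructor <;> nlinarith

open Polynomial in
theorem aux_full {n : ℕ} {P : ℝ[X]} (hd : P.natDegree ≤ n)
    (hb : ∀ x ∈ Set.Icc (-1 : ℝ) 1, |P.eval x| ≤ 1) {y : ℝ} (hy : y ∈ Set.Icc (-1 : ℝ) 1) :
    |(derivative (derivative P)).eval y| ≤ 4 * (n : ℝ) ^ 4 / 3 := by
  rcases le_total 0 y with h | h
  · exact aux_half hd hb h hy.2
  · have key := aux_half (n := n) (P := P.comp (-X)) (y := -y) ?_ ?_ (by linarith)
      (by linarith [hy.1])
    · simpa [derivative_comp] using key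
    · rw [natDegree_comp]; simpa using hd
    · intro x hx
      simpa using hb (-x) ⟨by linarith [hx.2], by linarith [hx.1]⟩

open Polynomial in
/-- Near an interior maximum the polynomial stays at least `1/2`. -/
theorem aux_near {n : ℕ} (hn : 1 ≤ n) {P : ℝ[X]} (hd : P.natDegree ≤ n)
    (hb : ∀ x ∈ Set.Icc (-1 : ℝ) 1, |P.eval x| ≤ 1) {y t : ℝ} (hy : y ∈ Set.Icc (-1 : ℝ) 1)
    (ht : t ∈ Set.Icc (-1 : ℝ) 1) (hmax : |P.eval y| = 1) (hcrit : (derivative P).eval y = 0)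
    (hyt : |t - y| ≤ 1 / (2 * (n : ℝ) ^ 2)) : 1 / 2 ≤ |P.eval t| := by
  set B : ℝ := 4 * (n : ℝ) ^ 4 / 3 with hB
  have hsub : Set.uIcc y t ⊆ Set.Icc (-1 : ℝ) 1 := Set.uIcc_subset_Icc hy ht
  have d1 : ∀ z ∈ Set.uIcc y t, ‖(derivative P).eval z‖ ≤ B * |t - y| := by
    intro z hz
    have := (convex_uIcc y t).norm_image_sub_le_of_norm_hasDerivWithin_le
      (f := fun w => (derivative P).eval w) (C := B)
      (fun w _ => ((derivative P).hasDerivAt w).hasDerivWithinAt)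
      (fun w hw => aux_full hd hb (hsub hw)) Set.left_mem_uIcc hz
    rw [hcrit, sub_zero] at this
    refine this.trans ?_
    gcongr
    exact Set.abs_sub_left_of_mem_uIcc hz
  have d2 := (convex_uIcc y t).norm_image_sub_le_of_norm_hasDerivWithin_le
      (f := fun w => P.eval w) (C := B * |t - y|)
      (fun w _ => (P.hasDerivAt w).hasDerivWithinAt) d1 Set.left_mem_uIcc Set.right_mem_uIcc
  simp only [Real.norm_eq_abs] at d2
  have hn' : (1 : ℝ) ≤ n := by exact_mod_cast hn
  have h3 : B * |t - y| * |t - y| ≤ 1 / 3 := by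
    calc B * |t - y| * |t - y| ≤ B * (1 / (2 * (n : ℝ) ^ 2)) * (1 / (2 * (n : ℝ) ^ 2)) := by
          gcongr
      _ = 1 / 3 := by rw [hB]; field_simp; norm_num
  have := abs_sub_abs_le_abs_sub (P.eval y) (P.eval t)
  rw [abs_sub_comm, hmax] at this
  linarith

theorem aux_node {N : ℕ} (hN : 0 < N) {y : ℝ} (hy : y ∈ Set.Icc (-1 : ℝ) 1) :
    ∃ k : Fin (N + 1), |(-1 + 2 * (k : ℝ) / N) - y| ≤ 1 / N := by
  have hN' : (0 : ℝ) < N := by exact_mod_cast hN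
  obtain ⟨h1, h2⟩ := hy
  have hnn : 0 ≤ (y + 1) * N / 2 + 1 / 2 := by
    have : 0 ≤ (y + 1) * N := mul_nonneg (by linarith) hN'.le
    linarith
  have a := Nat.floor_le hnn
  have b := Nat.lt_floor_add_one ((y + 1) * N / 2 + 1 / 2)
  refine ⟨⟨⌊(y + 1) * N / 2 + 1 / 2⌋₊, ?_⟩, ?_⟩
  · rw [Nat.floor_lt hnn]
    push_cast
    nlinarith
  · simp only
    generalize (⌊(y + 1) * N / 2 + 1 / 2⌋₊ : ℝ) = k at a b
    have : (-1 + 2 * k / N) - y = (2 * k - (y + 1) * N) / N := by field_simp; ring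
    rw [this, abs_div, abs_of_pos hN']
    gcongr
    rw [abs_le]
    constructor <;> linarith

/-- Uniform stability of polynomial overtesting on equidistant points: if
`n ≥ 1`, `N ≥ 2n²`, and `t_k = -1 + 2k/N` for `k = 0, …, N` are the `N + 1`
equidistant points in `[-1, 1]`, then every real polynomial `p` of degree at
most `n` satisfies `sup_{x ∈ [-1,1]} |p(x)| ≤ 2 max_{0 ≤ k ≤ N} |p(t_k)|`. -/
theorem polynomial_equidistant_overtesting_stability
    (n N : ℕ) (hn : 1 ≤ n) (hN : 2 * n ^ 2 ≤ N)
    (p : Polynomial ℝ) (hdeg : p.natDegree ≤ n) :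
    ∀ x ∈ Set.Icc (-1 : ℝ) 1,
      |p.eval x| ≤ 2 * Finset.univ.sup' Finset.univ_nonempty
        (fun k : Fin (N + 1) => |p.eval (-1 + 2 * (k : ℝ) / N)|) := by
  intro x hx
  have hNpos : 0 < N := lt_of_lt_of_le (by positivity) hN
  have hNr : (0 : ℝ) < N := by exact_mod_cast hNpos
  have hle : ∀ k : Fin (N + 1), |p.eval (-1 + 2 * (k : ℝ) / N)| ≤
      Finset.univ.sup' Finset.univ_nonempty
        (fun k : Fin (N + 1) => |p.eval (-1 + 2 * (k : ℝ) / N)|) := fun k =>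
    Finset.le_sup' (fun k : Fin (N + 1) => |p.eval (-1 + 2 * (k : ℝ) / N)|) (Finset.mem_univ k)
  obtain ⟨y, hy, hmax⟩ := isCompact_Icc.exists_isMaxOn (⟨x, hx⟩ : (Set.Icc (-1 : ℝ) 1).Nonempty)
    (f := fun z => |p.eval z|) (by fun_prop)
  have hmax' : ∀ z ∈ Set.Icc (-1 : ℝ) 1, |p.eval z| ≤ |p.eval y| := fun z hz => hmax hz
  suffices h : ∃ k : Fin (N + 1), |p.eval y| ≤ 2 * |p.eval (-1 + 2 * (k : ℝ) / N)| by
    obtain ⟨k, hk⟩ := h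
    linarith [hmax' x hx, hle k]
  rcases eq_or_ne (p.eval y) 0 with h0 | h0
  · exact ⟨0, by rw [h0, abs_zero]; positivity⟩
  rcases eq_or_lt_of_le hy.1 with e | hl
  · refine ⟨0, ?_⟩
    simp only [Fin.val_zero, Nat.cast_zero, mul_zero, zero_div, add_zero, e]
    linarith [abs_nonneg (p.eval y)]
  rcases eq_or_lt_of_le hy.2 with e | hr
  · refine ⟨Fin.last N, ?_⟩
    have : (-1 + 2 * ((Fin.last N : Fin (N + 1)) : ℕ) / N : ℝ) = y := by
      rw [e, Fin.val_last]; field_simp; norm_num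
    rw [this]
    linarith [abs_nonneg (p.eval y)]
  have hnhds : Set.Icc (-1 : ℝ) 1 ∈ nhds y := Icc_mem_nhds hl hr
  set q : Polynomial ℝ := Polynomial.C (p.eval y)⁻¹ * p with hq
  have hqe : ∀ z, q.eval z = (p.eval y)⁻¹ * p.eval z := by intro z; simp [hq]
  have hqy : q.eval y = 1 := by rw [hqe]; exact inv_mul_cancel₀ h0
  have hpos : 0 < |p.eval y| := abs_pos.mpr h0
  have hqb : ∀ z ∈ Set.Icc (-1 : ℝ) 1, |q.eval z| ≤ 1 := by
    intro z hz
    rw [hqe, abs_mul, abs_inv, inv_mul_le_one₀ hpos]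
    exact hmax' z hz
  have hcrit : (Polynomial.derivative q).eval y = 0 := by
    have hloc : IsLocalMax (fun z => q.eval z) y := by
      filter_upwards [hnhds] with z hz
      rw [hqy]
      exact (le_abs_self _).trans (hqb z hz)
    exact hloc.hasDerivAt_eq_zero (q.hasDerivAt y)
  obtain ⟨k, hk⟩ := aux_node hNpos hy
  refine ⟨k, ?_⟩
  have hn' : (1 : ℝ) ≤ n := by exact_mod_cast hn
  have hNn : 2 * (n : ℝ) ^ 2 ≤ N := by exact_mod_cast hN
  have ht : (-1 + 2 * (k : ℝ) / N) ∈ Set.Icc (-1 : ℝ) 1 := by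
    have hkN : (k : ℝ) ≤ N := by exact_mod_cast Nat.lt_succ_iff.mp k.2
    have h1 : 2 * (k : ℝ) / N ≤ 2 := by rw [div_le_iff₀ hNr]; linarith
    have h2 : 0 ≤ 2 * (k : ℝ) / N := by positivity
    constructor <;> linarith
  have key := aux_near hn (P := q) (by
      rw [hq]; exact (Polynomial.natDegree_C_mul_le _ _).trans hdeg) hqb hy ht
    (by rw [hqy, abs_one]) hcrit
    (hk.trans (one_div_le_one_div_of_le (by positivity) hNn))
  rw [hqe, abs_mul, abs_inv, inv_mul_eq_div, le_div_iff₀ hpos] at key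
  linarith
end
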